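/- Let f and g be harmonic polynomials on ℝⁿ. Then for every p ∈ ℕ, Δᵖ(f·g) = 2ᵖ Σ_{i₁,…,i_p = 1}^{n} (∂_{i₁}⋯∂_{i_p} f)·(∂_{i₁}⋯∂_{i_p} g), where ∂_i denotes the partial derivative with respect to x_i. -/

import Mathlib

open MeasureTheory Metric MvPolynomial

noncomputable section

/-- `ℝⁿ` as a Euclidean space. -/
abbrev En (n : ℕ) : Type := EuclideanSpace ℝ (Fin n)

/-- The Laplace operator `Δ = ∂²/∂x₁² + … + ∂²/∂xₙ²` acting on polynomials. -/
def lap (n : ℕ) (P : MvPolynomial (Fin n) ℂ) : MvPolynomial (Fin n) ℂ :=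
  ∑ i : Fin n, pderiv i (pderiv i P)

/-- A polynomial is harmonic if `ΔP = 0`. -/
def IsHarmonicPoly (n : ℕ) (P : MvPolynomial (Fin n) ℂ) : Prop := lap n P = 0

/-- The polyharmonic degree `d(P) = min {N : Δ^(N+1) P = 0}`. -/
def pdeg (n : ℕ) (P : MvPolynomial (Fin n) ℂ) : ℕ := sInf {N : ℕ | (lap n)^[N + 1] P = 0}

/-- Evaluation of a polynomial at a real point of `ℝⁿ`. -/
def evalR {n : ℕ} (P : MvPolynomial (Fin n) ℂ) (x : En n) : ℂ :=
  eval (fun i => (x i : ℂ)) P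

/-- Evaluation of a polynomial at `ζθ`, i.e. after substituting `ζ θ i` for `x i`. -/
def evalC {n : ℕ} (P : MvPolynomial (Fin n) ℂ) (ζ : ℂ) (θ : En n) : ℂ :=
  eval (fun i => ζ * (θ i : ℂ)) P

/-- The surface measure on the unit sphere `S^{n-1} ⊂ ℝⁿ`. -/
def sphereMeasure (n : ℕ) : Measure (sphere (0 : En n) 1) :=
  (volume : Measure (En n)).toSphere

/-- `ω_n`, the surface area of the unit sphere `S^{n-1}`. -/
def omegaN (n : ℕ) : ℝ := ((sphereMeasure n) Set.univ).toReal

/-- The analytic continuation of `ζ ↦ r(ζθ − x)ⁿ = |ζθ − x|ⁿ` to `|ζ| > |x|`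
(principal branch; for real `ζ = ρ > |x|` it equals `|ρθ − x|ⁿ`, for `θ` on the
unit sphere). -/
def rPow (n : ℕ) (ζ : ℂ) (θ x : En n) : ℂ :=
  ζ ^ n * (1 - 2 * ((inner ℝ θ x : ℝ) : ℂ) / ζ + ((‖x‖ : ℂ)) ^ 2 / ζ ^ 2) ^ ((n : ℂ) / 2)

/-- Integral of a complex-valued function against a finite signed measure
(via the Jordan decomposition). -/
def sInt {α : Type*} [MeasurableSpace α] (μ : SignedMeasure α) (f : α → ℂ) : ℂ :=
  ∫ x, f x ∂μ.toJordanDecomposition.posPart - ∫ x, f x ∂μ.toJordanDecomposition.negPart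

/-- The support of the signed measure `μ` is contained in the set `s`. -/
def SuppIn {α : Type*} [MeasurableSpace α] (μ : SignedMeasure α) (s : Set α) : Prop :=
  μ.totalVariation sᶜ = 0

/-- The multivariate Markov transform of a finite signed measure. -/
def markov {n : ℕ} (μ : SignedMeasure (En n)) (ζ : ℂ) (θ : En n) : ℂ :=
  (omegaN n : ℂ)⁻¹ * sInt μ fun x => ζ ^ (n - 1) / rPow n ζ θ x

/-- The multivariate Markov transform of a (nonnegative) measure. -/
def markovM {n : ℕ} (μ : Measure (En n)) (ζ : ℂ) (θ : En n) : ℂ :=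
  (omegaN n : ℂ)⁻¹ * ∫ x, ζ ^ (n - 1) / rPow n ζ θ x ∂μ

/-- The function of the second kind `Q_P` for a signed measure. -/
def qP {n : ℕ} (μ : SignedMeasure (En n)) (P : MvPolynomial (Fin n) ℂ) (ζ : ℂ) (θ : En n) : ℂ :=
  (omegaN n : ℂ)⁻¹ * sInt μ fun x => (evalC P ζ θ - evalR P x) * ζ ^ (n - 1) / rPow n ζ θ x

/-- The function of the second kind `Q_P` for a (nonnegative) measure. -/
def qPM {n : ℕ} (μ : Measure (En n)) (P : MvPolynomial (Fin n) ℂ) (ζ : ℂ) (θ : En n) : ℂ :=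
  (omegaN n : ℂ)⁻¹ * ∫ x, (evalC P ζ θ - evalR P x) * ζ ^ (n - 1) / rPow n ζ θ x ∂μ

/-- The rest function `R_P` for a signed measure. -/
def restP {n : ℕ} (μ : SignedMeasure (En n)) (P : MvPolynomial (Fin n) ℂ) (ζ : ℂ) (θ : En n) : ℂ :=
  (omegaN n : ℂ)⁻¹ * sInt μ fun x => evalR P x * ζ ^ (n - 1) / rPow n ζ θ x
/-- Iterated partial derivative `∂_{I 0} ⋯ ∂_{I (p-1)} f`. -/
def pderivMulti {n p : ℕ} (I : Fin p → Fin n) (f : MvPolynomial (Fin n) ℂ) :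
    MvPolynomial (Fin n) ℂ :=
  (List.ofFn I).foldr (fun i q => pderiv i q) f

theorem aux_pderiv_comm {n : ℕ} (i j : Fin n) (P : MvPolynomial (Fin n) ℂ) :
    pderiv i (pderiv j P) = pderiv j (pderiv i P) := by
  have h : ⁅(pderiv i : Derivation ℂ (MvPolynomial (Fin n) ℂ) (MvPolynomial (Fin n) ℂ)),
      (pderiv j : Derivation ℂ (MvPolynomial (Fin n) ℂ) (MvPolynomial (Fin n) ℂ))⁆ = 0 := by
    apply MvPolynomial.derivation_ext
    intro k
    simp only [Derivation.commutator_apply, pderiv_X, Pi.single_apply, Derivation.coe_zero,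
      Pi.zero_apply]
    split_ifs <;> simp
  have h2 := congrArg (fun D => D P) h
  simpa [Derivation.commutator_apply, sub_eq_zero] using h2

theorem aux_lap_pderiv {n : ℕ} (i : Fin n) (P : MvPolynomial (Fin n) ℂ)
    (hP : IsHarmonicPoly n P) : IsHarmonicPoly n (pderiv i P) := by
  unfold IsHarmonicPoly lap at *
  have h2 := congrArg (pderiv i) hP
  rw [map_sum, map_zero] at h2
  rw [← h2]
  refine Finset.sum_congr rfl fun j _ => ?_
  rw [aux_pderiv_comm j i, aux_pderiv_comm j i]

theorem aux_cons {n p : ℕ} (i : Fin n) (I : Fin p → Fin n) (P : MvPolynomial (Fin n) ℂ) :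
    pderivMulti (Fin.cons i I : Fin (p + 1) → Fin n) P = pderiv i (pderivMulti I P) := by
  simp [pderivMulti, List.ofFn_succ]

theorem aux_multi {n p : ℕ} (I : Fin p → Fin n) (P : MvPolynomial (Fin n) ℂ)
    (hP : IsHarmonicPoly n P) : IsHarmonicPoly n (pderivMulti I P) := by
  unfold pderivMulti
  induction List.ofFn I with
  | nil => simpa using hP
  | cons a l ih => simpa using aux_lap_pderiv a _ ih

theorem aux_mul {n : ℕ} (f g : MvPolynomial (Fin n) ℂ)
    (hf : IsHarmonicPoly n f) (hg : IsHarmonicPoly n g) :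
    lap n (f * g) = 2 * ∑ i, pderiv i f * pderiv i g := by
  have h : lap n (f * g) = f * lap n g + g * lap n f + 2 * ∑ i, pderiv i f * pderiv i g := by
    simp only [lap, Finset.mul_sum, ← Finset.sum_add_distrib]
    refine Finset.sum_congr rfl fun i _ => ?_
    simp only [Derivation.leibniz, map_add, smul_eq_mul]
    ring
  rw [h, hf, hg]; simp

theorem aux_lap_sum {n : ℕ} {ι : Type} (s : Finset ι) (F : ι → MvPolynomial (Fin n) ℂ) :
    lap n (∑ k ∈ s, F k) = ∑ k ∈ s, lap n (F k) := by
  simp only [lap, map_sum]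
  exact Finset.sum_comm

theorem aux_lap_two {n : ℕ} (p : ℕ) (P : MvPolynomial (Fin n) ℂ) :
    lap n (2 ^ p * P) = 2 ^ p * lap n P := by
  have h : ∀ Q : MvPolynomial (Fin n) ℂ, 2 ^ p * Q = (2 ^ p : ℂ) • Q := by
    intro Q
    rw [MvPolynomial.smul_eq_C_mul, C_pow, show (C 2 : MvPolynomial (Fin n) ℂ) = 2 from map_ofNat C 2]
  simp only [h, lap, Derivation.map_smul, Finset.smul_sum]

/-- For harmonic `f, g`:
`Δᵖ(f·g) = 2ᵖ Σ_{i₁,…,i_p} (∂_{i₁}⋯∂_{i_p} f)·(∂_{i₁}⋯∂_{i_p} g)`. -/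
theorem lap_pow_mul_of_harmonic
    (n : ℕ) (f g : MvPolynomial (Fin n) ℂ)
    (hf : IsHarmonicPoly n f) (hg : IsHarmonicPoly n g) :
    ∀ p : ℕ, (lap n)^[p] (f * g)
      = 2 ^ p * ∑ I : Fin p → Fin n, pderivMulti I f * pderivMulti I g := by
  intro p
  induction p with
  | zero => simp [pderivMulti]
  | succ p ih =>
    rw [Function.iterate_succ_apply', ih, aux_lap_two, aux_lap_sum, pow_succ, mul_assoc]
    congr 1
    rw [← (Fin.consEquiv (fun _ : Fin (p + 1) => Fin n)).sum_comp, Fintype.sum_prod_type_right,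
      Finset.mul_sum]
    refine Finset.sum_congr rfl fun I _ => ?_
    rw [aux_mul _ _ (aux_multi I f hf) (aux_multi I g hg)]
    congr 1
    refine Finset.sum_congr rfl fun i _ => ?_
    rw [← aux_cons, ← aux_cons]
    rfl
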